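/- There exist absolute constants C, K₁, K₂ > 0 with the following property. Let F be a finite abelian group of order 2n, X a subgroup of F of index 2 with coset Y = F \ X, and D ⊆ Y a generating set of F with D = −D, |D| = d, such that d ≥ C · (log d)^8 · (log n), d ≤ n^{1/3}, and d₂ := |2D| ≥ d · (log d)^3. Then for all integers a, g with t = g − a there exists a family 𝒞₁ of subsets of Y such that: (1) every C ∈ 𝒞₁ satisfies |C| ≤ K₁ · t · d₂ / (log d)^3; (2) |𝒞₁| ≤ 2^{K₂ · t / log d}; and (3) for every small 2-linked set A ⊆ X with |[A]| = a and |N(A)| = g, there is C ∈ 𝒞₁ containing the boundary G' = {v ∈ N(A) : N(v) ⊄ [A]}. -/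

import Mathlib

open Pointwise Real

/-- The closure `[A] = {u ∈ X : N(u) ⊆ N(A)}` for the bipartite Cayley graph with parts
`X`, `Y` and generator set `D ⊆ Y`; here `N(S) = S + D`. -/
def closureSet {F : Type*} [AddCommGroup F] (D X A : Set F) : Set F :=
  {u ∈ X | {u} + D ⊆ A + D}

/-- The square graph of the Cayley graph with generator set `D`:
`u ~ v` iff `u ≠ v` and `N(u) ∩ N(v) ≠ ∅`. -/
def squareGraph {F : Type*} [AddCommGroup F] (D : Set F) : SimpleGraph F :=
  SimpleGraph.fromRel (fun u v => (({u} + D) ∩ ({v} + D)).Nonempty)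

/-- `A` is 2-linked if it is connected in the square graph. -/
def TwoLinked {F : Type*} [AddCommGroup F] (D A : Set F) : Prop :=
  ((squareGraph D).induce A).Connected

/-- The boundary `G' = {v ∈ N(A) : N(v) ∩ [A]ᶜ ≠ ∅}` of `G = N(A)`. -/
def boundarySet {F : Type*} [AddCommGroup F] (D X A : Set F) : Set F :=
  {v ∈ A + D | ¬ ({v} + D ⊆ closureSet D X A)}


/-- The data of a set `A`, its neighbourhood `G`, in abstract form. -/
structure Core {F : Type} [AddCommGroup F] (D A G : Finset F) (t : ℕ) : Prop where
  neg : ∀ x ∈ D, -x ∈ D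
  h1 : ∀ u ∈ A, ∀ x ∈ D, u + x ∈ G
  h2 : ∀ u, u ∉ A → ∃ x ∈ D, u + x ∉ G
  h3 : ∀ v ∈ G, ∃ x ∈ D, v + x ∈ A
  hc : G.card = A.card + t

set_option linter.unusedSectionVars false

namespace Core
open Finset
variable {F : Type} [AddCommGroup F] [DecidableEq F] {D A G : Finset F} {t : ℕ}

/-- number of neighbours of `v` outside `A` -/
def bdeg (D A : Finset F) (v : F) : ℕ := #(D.filter (fun x => v + x ∉ A))

theorem out (h : Core D A G t) {w : F} (hw : w ∉ G) {x : F} (hx : x ∈ D) : w + x ∉ A := by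
  intro hA
  apply hw
  have := h.h1 _ hA _ (h.neg x hx)
  simpa using this

theorem neg2 (h : Core D A G t) {z : F} (hz : z ∈ D + D) : -z ∈ D + D := by
  obtain ⟨x, hx, y, hy, rfl⟩ := Finset.mem_add.1 hz
  exact Finset.mem_add.2 ⟨-x, h.neg x hx, -y, h.neg y hy, by abel⟩

theorem compl_le (h : Core D A G t) (p : F → Prop) [DecidablePred p] (x : F) (hx : x ∈ D)
    (hp : ∀ u ∈ A, p (u - x)) : #(G.filter (fun v => ¬ p v)) ≤ t := by
  have h1 : #A ≤ #(G.filter p) := by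
    apply Finset.card_le_card_of_injOn (fun u => u - x)
    · intro u hu
      have := h.h1 u hu _ (h.neg x hx)
      simp only [Finset.coe_filter, Set.mem_ofPred_eq]
      exact ⟨by simpa [sub_eq_add_neg] using this, hp u hu⟩
    · intro a _ b _ hab
      simpa using hab
  have h2 := Finset.card_filter_add_card_filter_not (s := G) p
  have h3 := h.hc
  omega

theorem sum_bdeg (h : Core D A G t) : ∑ v ∈ G, bdeg D A v ≤ t * #D := by
  have : ∑ v ∈ G, bdeg D A v = ∑ x ∈ D, #(G.filter (fun v => v + x ∉ A)) :=
    Finset.sum_card_bipartiteAbove_eq_sum_card_bipartiteBelow (fun v x => v + x ∉ A)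
  rw [this, mul_comm]
  apply Finset.sum_le_card_nsmul
  intro x hx
  exact h.compl_le (fun v => v + x ∈ A) x hx (fun u hu => by simpa using hu)

/-- Crossing degree along `D + D`. -/
def cdeg (D G : Finset F) (y : F) : ℕ := #((D + D).filter (fun s => ¬ (y ∈ G ↔ y + s ∈ G)))

theorem sum_cdeg [Fintype F] (h : Core D A G t) : ∑ y, cdeg D G y ≤ 2 * t * #(D + D) := by
  have : ∑ y, cdeg D G y = ∑ s ∈ D + D, #((univ : Finset F).filter
      (fun y => ¬ (y ∈ G ↔ y + s ∈ G))) :=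
    Finset.sum_card_bipartiteAbove_eq_sum_card_bipartiteBelow (fun y s => ¬ (y ∈ G ↔ y + s ∈ G))
  rw [this, mul_comm]
  apply Finset.sum_le_card_nsmul
  intro s hs
  have key : ∀ s ∈ D + D, #(G.filter (fun v => ¬ (v + s ∈ G))) ≤ t := by
    intro s hs
    obtain ⟨x, hx, y, hy, rfl⟩ := Finset.mem_add.1 hs
    apply h.compl_le (fun v => v + (x + y) ∈ G) x hx
    intro u hu
    have := h.h1 u hu y hy
    convert this using 1
    abel
  have k1 := key s hs
  have k2 := key (-s) (h.neg2 hs)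
  have : (univ : Finset F).filter (fun y => ¬ (y ∈ G ↔ y + s ∈ G)) ⊆
      G.filter (fun v => ¬ (v + s ∈ G)) ∪ (G.filter (fun v => ¬ (v + -s ∈ G))).image (· + -s) := by
    intro y hy
    simp only [mem_filter, mem_univ, true_and, mem_union, mem_image] at hy ⊢
    by_cases hyG : y ∈ G
    · left; tauto
    · right
      refine ⟨y + s, ⟨by tauto, by simpa using hyG⟩, by simp⟩
  have h4 := (card_le_card this).trans (card_union_le _ _)
  have h5 := Finset.card_image_le (s := G.filter (fun v => ¬ (v + -s ∈ G))) (f := (· + -s))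
  omega

/-- Local richness of the boundary. -/
theorem local_bdeg (h : Core D A G t) {v : F} (hv : v ∈ G) {x : F} (hx : x ∈ D)
    (hvx : v + x ∉ A) :
    #D * #D ≤ 4 * ∑ y ∈ G.filter (fun y => ∃ s ∈ 4 • D, y = v + s), bdeg D A y := by
  -- any injectively parametrised family of boundary edges gives a lower bound
  set B := G.filter (fun y => ∃ s ∈ 4 • D, y = v + s) with hB
  have hsum : ∑ y ∈ B, bdeg D A y = #(B.sigma (fun y => D.filter (fun x => y + x ∉ A))) := by
    rw [card_sigma]; rfl
  have fam : ∀ (P : Finset (F × F)) (f : F × F → F) (e : F × F → F),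
      (∀ p ∈ P, f p ∈ B ∧ e p ∈ D ∧ f p + e p ∉ A) →
      (∀ p ∈ P, ∀ q ∈ P, f p = f q → e p = e q → p = q) →
      #P ≤ ∑ y ∈ B, bdeg D A y := by
    intro P f e h1 h2
    rw [hsum]
    apply Finset.card_le_card_of_injOn (fun p => (⟨f p, e p⟩ : Σ _ : F, F))
    · intro p hp
      have := h1 p hp
      simp only [coe_sigma, Set.mem_sigma_iff, mem_coe, mem_filter]
      tauto
    · intro p hp q hq hpq
      simp only [Sigma.mk.injEq, heq_eq_eq] at hpq
      exact h2 p hp q hq hpq.1 hpq.2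
  have four : ∀ a ∈ D, ∀ b ∈ D, ∀ c ∈ D, ∀ e ∈ D, a + b + c + e ∈ 4 • D := by
    intro a ha b hb c hc e he
    have : 4 • D = D + D + D + D := by abel
    rw [this]
    exact add_mem_add (add_mem_add (add_mem_add ha hb) hc) he
  have two : ∀ a ∈ D, ∀ b ∈ D, a + b ∈ 4 • D := by
    intro a ha b hb
    have := four a ha b hb x hx (-x) (h.neg x hx)
    simpa using this
  obtain ⟨y, hy, hvy⟩ := h.h3 v hv
  obtain ⟨x', hx', hw⟩ := h.h2 _ hvx
  set P := D ×ˢ D with hP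
  have hPc : #P = #D * #D := card_product _ _
  -- four families
  set P1 := P.filter (fun p => v + p.1 ∉ A ∧ v + p.1 + p.2 ∈ G)
  set P2 := P.filter (fun p => v + p.1 ∉ A ∧ v + p.1 + p.2 ∉ G)
  set P3 := P.filter (fun p => v + x + p.1 ∈ G ∧ v + x + p.1 + p.2 ∉ A)
  set P4 := P.filter (fun p => v + x + p.1 ∈ G ∧ v + x + p.1 + p.2 ∈ A)
  have hcov : P ⊆ P1 ∪ P2 ∪ (P3 ∪ P4) := by
    intro p hp
    have hp' := mem_product.1 hp
    simp only [P1, P2, P3, P4, mem_union, mem_filter]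
    by_cases hA : v + p.1 ∈ A
    · have : v + x + p.1 ∈ G := by
        have := h.h1 _ hA x hx
        convert this using 1; abel
      tauto
    · tauto
  have c1 : #P1 ≤ ∑ y ∈ B, bdeg D A y := by
    apply fam P1 (fun p => v + p.1 + p.2) (fun p => -p.2)
    · intro p hp
      simp only [P1, P, mem_filter, mem_product] at hp
      obtain ⟨⟨a1, a2⟩, a3, a4⟩ := hp
      refine ⟨mem_filter.2 ⟨a4, p.1 + p.2, two _ a1 _ a2, by abel⟩, h.neg _ a2, by simpa using a3⟩
    · rintro ⟨p1, p2⟩ _ ⟨q1, q2⟩ _ e1 e2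
      simp only [neg_inj] at e1 e2
      subst e2
      simpa using e1
  have c2 : #P2 ≤ ∑ y ∈ B, bdeg D A y := by
    apply fam P2 (fun p => v + y + p.1) (fun p => p.2)
    · intro p hp
      simp only [P2, P, mem_filter, mem_product] at hp
      obtain ⟨⟨a1, a2⟩, a3, a4⟩ := hp
      refine ⟨mem_filter.2 ⟨h.h1 _ hvy _ a1, y + p.1, two _ hy _ a1, by abel⟩, a2, ?_⟩
      have := h.out a4 hy
      convert this using 2; abel
    · rintro ⟨p1, p2⟩ _ ⟨q1, q2⟩ _ e1 e2
      simp only at e1 e2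
      subst e2
      simpa using e1
  have c3 : #P3 ≤ ∑ y ∈ B, bdeg D A y := by
    apply fam P3 (fun p => v + x + p.1) (fun p => p.2)
    · intro p hp
      simp only [P3, P, mem_filter, mem_product] at hp
      obtain ⟨⟨a1, a2⟩, a3, a4⟩ := hp
      exact ⟨mem_filter.2 ⟨a3, x + p.1, two _ hx _ a1, by abel⟩, a2, a4⟩
    · rintro ⟨p1, p2⟩ _ ⟨q1, q2⟩ _ e1 e2
      simp only at e1 e2
      subst e2
      simpa using e1
  have c4 : #P4 ≤ ∑ y ∈ B, bdeg D A y := by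
    apply fam P4 (fun p => v + x + x' + p.1 + p.2) (fun p => -p.2)
    · intro p hp
      simp only [P4, P, mem_filter, mem_product] at hp
      obtain ⟨⟨a1, a2⟩, a3, a4⟩ := hp
      refine ⟨mem_filter.2 ⟨?_, x + x' + p.1 + p.2, four _ hx _ hx' _ a1 _ a2, by abel⟩,
        h.neg _ a2, ?_⟩
      · have := h.h1 _ a4 _ hx'
        convert this using 1; abel
      · have := h.out hw a1
        simpa using this
    · rintro ⟨p1, p2⟩ _ ⟨q1, q2⟩ _ e1 e2
      simp only [neg_inj] at e1 e2
      subst e2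
      simpa using e1
  have h4 := card_le_card hcov
  have h5 := card_union_le (P1 ∪ P2) (P3 ∪ P4)
  have h6 := card_union_le P1 P2
  have h7 := card_union_le P3 P4
  omega

/-- number of neighbours outside `G` -/
def odeg (D G : Finset F) (u : F) : ℕ := #(D.filter (fun x => u + x ∉ G))

/-- vertices outside `A` with few neighbours outside `G` -/
def U [Fintype F] (D A G : Finset F) (k : ℕ) : Finset F :=
  univ.filter (fun u => u ∉ A ∧ odeg D G u < 2 * k)

/-- exceptional vertices -/
def W [Fintype F] (D A G : Finset F) (k m : ℕ) : Finset F :=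
  univ.filter (fun w => w ∉ G ∧ m ≤ #(D.filter (fun x => w + x ∈ U D A G k)))

theorem card_U [Fintype F] (h : Core D A G t) (hD : 0 < #D) (k : ℕ) (hk : 4 * k ≤ #D) :
    #(U D A G k) ≤ 2 * t := by
  have h1 : ∑ u ∈ U D A G k, #(G.filter (fun v => v - u ∈ D)) ≤ t * #D := by
    refine le_trans ?_ h.sum_bdeg
    have := Finset.sum_card_bipartiteAbove_eq_sum_card_bipartiteBelow
      (s := U D A G k) (t := G) (fun u v => v - u ∈ D)
    unfold bipartiteAbove bipartiteBelow at this
    rw [this]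
    apply sum_le_sum
    intro v hv
    apply card_le_card_of_injOn (fun u => u - v)
    · intro u hu
      simp only [U, coe_filter, Set.mem_ofPred_eq, mem_filter, mem_univ, true_and] at hu ⊢
      refine ⟨?_, by simpa using hu.1.1⟩
      have := h.neg _ hu.2
      simpa using this
    · intro a _ b _ hab
      simpa using hab
  have h2 : ∀ u ∈ U D A G k, #D ≤ 2 * #(G.filter (fun v => v - u ∈ D)) := by
    intro u hu
    simp only [U, mem_filter, mem_univ, true_and] at hu
    have h3 : #(D.filter (fun x => u + x ∈ G)) ≤ #(G.filter (fun v => v - u ∈ D)) := by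
      apply card_le_card_of_injOn (fun x => u + x)
      · intro x hx
        simp only [coe_filter, Set.mem_ofPred_eq] at hx ⊢
        exact ⟨hx.2, by simpa using hx.1⟩
      · intro a _ b _ hab
        simpa using hab
    have h4 := Finset.card_filter_add_card_filter_not (s := D) (fun x => u + x ∈ G)
    have h5 := hu.2
    unfold odeg at h5
    omega
  have h3 := Finset.card_nsmul_le_sum _ _ _ h2
  rw [← mul_sum, smul_eq_mul] at h3
  have : #(U D A G k) * #D ≤ (2 * t) * #D := by nlinarith
  exact Nat.le_of_mul_le_mul_right this hD

theorem card_W [Fintype F] (h : Core D A G t) (hD : 0 < #D) (k m : ℕ) (hk : 4 * k ≤ #D) :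
    #(W D A G k m) * m ≤ 4 * t * k := by
  have h1 : ∀ w ∈ W D A G k m, m ≤ #((U D A G k).filter (fun u => u - w ∈ D)) := by
    intro w hw
    simp only [W, mem_filter, mem_univ, true_and] at hw
    refine hw.2.trans ?_
    apply card_le_card_of_injOn (fun x => w + x)
    · intro x hx
      simp only [coe_filter, Set.mem_ofPred_eq] at hx ⊢
      exact ⟨hx.2, by simpa using hx.1⟩
    · intro a _ b _ hab
      simpa using hab
  have h2 := Finset.card_nsmul_le_sum _ _ _ h1
  have := Finset.sum_card_bipartiteAbove_eq_sum_card_bipartiteBelow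
      (s := W D A G k m) (t := U D A G k) (fun w u => u - w ∈ D)
  unfold bipartiteAbove bipartiteBelow at this
  rw [this, smul_eq_mul] at h2
  have h3 : ∀ u ∈ U D A G k, #((W D A G k m).filter (fun w => u - w ∈ D)) ≤ 2 * k := by
    intro u hu
    have hu' := hu
    simp only [U, mem_filter, mem_univ, true_and] at hu'
    refine le_trans ?_ hu'.2.le
    apply card_le_card_of_injOn (fun w => w - u)
    · intro w hw
      simp only [W, coe_filter, Set.mem_ofPred_eq, mem_filter, mem_univ, true_and] at hw ⊢
      refine ⟨?_, by simpa using hw.1.1⟩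
      have := h.neg _ hw.2
      simpa using this
    · intro a _ b _ hab
      simpa using hab
  have h4 := Finset.sum_le_card_nsmul _ _ _ h3
  rw [smul_eq_mul] at h4
  have h5 := h.card_U hD k hk
  calc _ ≤ _ := h2
    _ ≤ _ := h4
    _ ≤ 2 * t * (2 * k) := Nat.mul_le_mul_right _ h5
    _ = _ := by ring

/-- the weight -/
def wt (D A G : Finset F) (y : F) : ℕ :=
  #D * cdeg D G y + #(D + D) * (if y ∈ G then bdeg D A y else 0)

theorem sum_wt [Fintype F] (h : Core D A G t) : ∑ y, wt D A G y ≤ 3 * t * (#D * #(D + D)) := by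
  unfold wt
  rw [sum_add_distrib, ← mul_sum, ← mul_sum, ← sum_filter]
  have h1 := h.sum_bdeg
  have h2 := h.sum_cdeg
  have h3 : univ.filter (fun y => y ∈ G) = G := by ext; simp
  rw [h3]
  have := Nat.mul_le_mul_left (#D) h2
  have := Nat.mul_le_mul_left (#(D + D)) h1
  nlinarith

theorem dichotomy [Fintype F] (h : Core D A G t) (M m : ℕ)
    (hk : 16 * M ≤ #D) (hm : 2 * m ≤ #D) {v : F} (hv : v ∈ G) {x : F} (hx : x ∈ D)
    (hvx : v + x ∉ A) :
    (∃ w ∈ W D A G (4 * M) m, ∃ s ∈ D + D, w = v + s) ∨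
      2 * M * (#D * #(D + D)) ≤ ∑ y ∈ (D + D).image (fun s => v + s), wt D A G y := by
  have hsw : ∑ y ∈ (D + D).image (fun s => v + s), wt D A G y
      = ∑ s ∈ D + D, wt D A G (v + s) := by
    rw [sum_image]
    intro a _ b _ hab
    simpa using hab
  rw [hsw]
  obtain ⟨y, hy, hvy⟩ := h.h3 v hv
  by_cases hcase : 4 * M ≤ odeg D G (v + x)
  · right
    set P := (D + D).filter (fun s => v + s ∈ G) with hP
    set Q := (D + D).filter (fun s => ¬ (v + s ∈ G)) with hQ
    have hPQ : #P + #Q = #(D + D) := Finset.card_filter_add_card_filter_not _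
    have hPk : 4 * M ≤ #P := by
      have : #D ≤ #P := by
        apply card_le_card_of_injOn (fun z => y + z)
        · intro z hz
          simp only [P, coe_filter, Set.mem_ofPred_eq]
          refine ⟨add_mem_add hy hz, ?_⟩
          rw [← add_assoc]
          exact h.h1 _ hvy _ hz
        · intro a _ b _ hab
          simpa using hab
      omega
    have hQk : 4 * M ≤ #Q := by
      refine hcase.trans ?_
      apply card_le_card_of_injOn (fun z => x + z)
      · intro z hz
        simp only [Q, coe_filter, Set.mem_ofPred_eq] at hz ⊢
        refine ⟨add_mem_add hx hz.1, ?_⟩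
        rw [← add_assoc]
        exact hz.2
      · intro a _ b _ hab
        simpa using hab
    have hPQ2 : 2 * M * #(D + D) ≤ #P * #Q := by
      rw [← hPQ]
      rcases le_total (#P) (#Q) with hle | hle <;> nlinarith
    have hcd : #P * #Q ≤ ∑ s ∈ D + D, cdeg D G (v + s) := by
      have e1 : ∑ s ∈ D + D, cdeg D G (v + s) = ∑ s ∈ P, cdeg D G (v + s) +
          ∑ s ∈ Q, cdeg D G (v + s) := (sum_filter_add_sum_filter_not _ _ _).symm
      have e2 : ∑ s ∈ P, #(Q.filter (fun z => ¬ (v + s + z ∈ G))) ≤ ∑ s ∈ P, cdeg D G (v + s) := by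
        apply sum_le_sum
        intro s hs
        apply card_le_card
        intro z hz
        simp only [P, Q, mem_filter] at hz hs ⊢
        tauto
      have e3 : ∑ s ∈ Q, #(P.filter (fun z => v + z + s ∈ G)) ≤ ∑ s ∈ Q, cdeg D G (v + s) := by
        apply sum_le_sum
        intro s hs
        apply card_le_card
        intro z hz
        simp only [P, Q, mem_filter] at hz hs ⊢
        rw [add_right_comm] at hz
        tauto
      have e4 : ∑ s ∈ P, #(Q.filter (fun z => v + s + z ∈ G)) =
          ∑ s ∈ Q, #(P.filter (fun z => v + z + s ∈ G)) :=
        Finset.sum_card_bipartiteAbove_eq_sum_card_bipartiteBelow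
          (s := P) (t := Q) (fun z s => v + z + s ∈ G)
      rw [← e4] at e3
      have e5 : ∑ s ∈ P, #(Q.filter (fun z => v + s + z ∈ G)) +
          ∑ s ∈ P, #(Q.filter (fun z => ¬ (v + s + z ∈ G))) = #P * #Q := by
        rw [← sum_add_distrib, ← smul_eq_mul, ← sum_const]
        apply sum_congr rfl
        intro s _
        exact Finset.card_filter_add_card_filter_not _
      omega
    have e6 : #D * ∑ s ∈ D + D, cdeg D G (v + s) ≤ ∑ s ∈ D + D, wt D A G (v + s) := by
      rw [mul_sum]
      apply sum_le_sum
      intro s _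
      unfold wt
      omega
    refine le_trans ?_ e6
    have := Nat.mul_le_mul_left (#D) (hPQ2.trans hcd)
    nlinarith
  · obtain ⟨x', hx', hw⟩ := h.h2 _ hvx
    by_cases hW : v + x + x' ∈ W D A G (4 * M) m
    · left
      exact ⟨_, hW, x + x', add_mem_add hx hx', by abel⟩
    · right
      have hW' : #(D.filter (fun z => v + x + x' + z ∈ U D A G (4 * M))) < m := by
        simp only [W, mem_filter, mem_univ, true_and] at hW
        by_contra hc
        exact hW ⟨hw, by omega⟩
      set u := v + x with hu
      have hgood := Finset.card_filter_add_card_filter_not (s := D)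
        (fun z => u + x' + z ∈ U D A G (4 * M))
      set Z := D.filter (fun z => ¬ (u + x' + z ∈ U D A G (4 * M))) with hZ
      -- edges
      have hz : ∀ z ∈ Z, 4 * M ≤ #((D.filter (fun y => u + y ∈ G)).filter
          (fun y => u + y + z ∉ A)) := by
        intro z hz
        simp only [Z, mem_filter, U, mem_univ, true_and] at hz
        obtain ⟨hzD, hz2⟩ := hz
        have hzA : u + x' + z ∉ A := h.out hw hzD
        have hz3 : 2 * (4 * M) ≤ odeg D G (u + x' + z) := by
          by_contra hc
          exact hz2 ⟨hzA, by omega⟩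
        have hsub : D.filter (fun y => u + x' + z + y ∉ G) ⊆
            ((D.filter (fun y => u + y ∈ G)).filter (fun y => u + y + z ∉ A)) ∪
            D.filter (fun y => u + y ∉ G) := by
          intro y hy
          simp only [mem_filter, mem_union] at hy ⊢
          by_cases hyG : u + y ∈ G
          · left
            refine ⟨⟨hy.1, hyG⟩, ?_⟩
            have := h.out hy.2 (h.neg _ hx')
            convert this using 2
            abel
          · right; exact ⟨hy.1, hyG⟩
        have h8 := (card_le_card hsub).trans (card_union_le _ _)
        unfold odeg at hz3 hcase
        omega
      have hs1 := Finset.card_nsmul_le_sum _ _ _ hz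
      have hs2 := Finset.sum_card_bipartiteAbove_eq_sum_card_bipartiteBelow
        (s := Z) (t := D.filter (fun y => u + y ∈ G)) (fun z y => u + y + z ∉ A)
      unfold bipartiteAbove bipartiteBelow at hs2
      rw [hs2, smul_eq_mul] at hs1
      have hs3 : ∑ y ∈ D.filter (fun y => u + y ∈ G), #(Z.filter (fun z => u + y + z ∉ A)) ≤
          ∑ s ∈ D + D, (if v + s ∈ G then bdeg D A (v + s) else 0) := by
        calc _ ≤ ∑ y ∈ D.filter (fun y => u + y ∈ G),
              (if v + (x + y) ∈ G then bdeg D A (v + (x + y)) else 0) := by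
              apply sum_le_sum
              intro y hy
              have hy2 := (mem_filter.1 hy).2
              rw [← add_assoc, ← hu, if_pos hy2]
              apply card_le_card
              exact filter_subset_filter _ (filter_subset _ _)
          _ = ∑ s ∈ (D.filter (fun y => u + y ∈ G)).image (fun y => x + y),
              (if v + s ∈ G then bdeg D A (v + s) else 0) := by
              rw [sum_image]
              intro a _ b _ hab
              simpa using hab
          _ ≤ _ := by
              apply sum_le_sum_of_subset
              intro s hs
              obtain ⟨y, hy, rfl⟩ := mem_image.1 hs
              exact add_mem_add hx (mem_filter.1 hy).1
      have e6 : #(D + D) * ∑ s ∈ D + D, (if v + s ∈ G then bdeg D A (v + s) else 0)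
          ≤ ∑ s ∈ D + D, wt D A G (v + s) := by
        rw [mul_sum]
        apply sum_le_sum
        intro s _
        unfold wt
        omega
      refine le_trans ?_ e6
      have e7 : 2 * M * #D ≤ #Z * (4 * M) := by
        have : #D ≤ 2 * #Z := by omega
        nlinarith
      have := Nat.mul_le_mul_left (#(D + D)) ((e7.trans hs1).trans hs3)
      nlinarith

end Core

namespace Core
open Finset
variable {F : Type} [AddCommGroup F] [DecidableEq F] {D A G : Finset F} {t : ℕ}

theorem greedy_step [Fintype F] (B : Finset F) (N : F → Finset F) (ν : F → ℕ) (S θ : ℝ)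
    (hS : ((∑ y, ν y : ℕ) : ℝ) ≤ S) (hθ : 0 < θ) (hB : B.Nonempty)
    (hN : ∀ v ∈ B, θ ≤ ((∑ y ∈ N v, ν y : ℕ) : ℝ)) :
    ∃ y, θ * #B ≤ S * #(B.filter (fun v => y ∈ N v)) := by
  by_contra hcon
  push Not at hcon
  have hSpos : 0 < S := by
    obtain ⟨v, hv⟩ := hB
    have h1 := hN v hv
    have h2 : ∑ y ∈ N v, ν y ≤ ∑ y, ν y := sum_le_sum_of_subset (subset_univ _)
    have h3 : ((∑ y ∈ N v, ν y : ℕ) : ℝ) ≤ ((∑ y, ν y : ℕ) : ℝ) := by exact_mod_cast h2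
    linarith
  have hBpos : (0 : ℝ) < #B := by exact_mod_cast hB.card_pos
  have e1 : ∑ y, ν y * #(B.filter (fun v => y ∈ N v)) = ∑ v ∈ B, ∑ y ∈ N v, ν y := by
    have : ∀ v ∈ B, ∑ y ∈ N v, ν y = ∑ y, if y ∈ N v then ν y else 0 := by
      intro v _
      rw [← sum_filter]
      congr 1
      ext; simp
    rw [sum_congr rfl this, sum_comm]
    apply sum_congr rfl
    intro y _
    rw [← sum_filter, sum_const, smul_eq_mul, mul_comm]
  have e2 : θ * #B ≤ ((∑ y, ν y * #(B.filter (fun v => y ∈ N v)) : ℕ) : ℝ) := by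
    rw [e1]
    push_cast
    have := Finset.card_nsmul_le_sum B (fun v => ((∑ y ∈ N v, ν y : ℕ) : ℝ)) θ hN
    rw [nsmul_eq_mul] at this
    push_cast at this
    linarith
  have hex : ∃ y, 0 < ν y := by
    by_contra hc
    push Not at hc
    obtain ⟨v, hv⟩ := hB
    have h1 := hN v hv
    rw [sum_eq_zero (fun y _ => Nat.le_zero.1 (hc y))] at h1
    simp at h1
    linarith
  obtain ⟨y0, hy0⟩ := hex
  have e3 : ∑ y, (ν y : ℝ) * (S * #(B.filter (fun v => y ∈ N v))) <
      ∑ y, (ν y : ℝ) * (θ * #B) := by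
    apply sum_lt_sum
    · intro y _
      exact mul_le_mul_of_nonneg_left (hcon y).le (by positivity)
    · exact ⟨y0, mem_univ _, mul_lt_mul_of_pos_left (hcon y0) (by exact_mod_cast hy0)⟩
  rw [← sum_mul] at e3
  have e4 : ∑ y, (ν y : ℝ) * (S * #(B.filter (fun v => y ∈ N v))) =
      S * ((∑ y, ν y * #(B.filter (fun v => y ∈ N v)) : ℕ) : ℝ) := by
    push_cast
    rw [mul_sum]
    apply sum_congr rfl
    intro y _
    ring
  rw [e4] at e3
  have e5 := mul_le_mul_of_nonneg_left e2 hSpos.le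
  push_cast at hS
  have e6 := mul_le_mul_of_nonneg_right hS (by positivity : 0 ≤ θ * #B)
  linarith

theorem greedy [Fintype F] (V : Finset F) (N : F → Finset F) (ν : F → ℕ) (S θ : ℝ)
    (hS : ((∑ y, ν y : ℕ) : ℝ) ≤ S) (hθ : 0 < θ)
    (hN : ∀ v ∈ V, θ ≤ ((∑ y ∈ N v, ν y : ℕ) : ℝ)) (q : ℕ) :
    ∃ T : Finset F, #T ≤ q ∧ (∀ y ∈ T, ∃ v ∈ V, y ∈ N v) ∧
      (#(V.filter (fun v => ∀ y ∈ N v, y ∉ T)) : ℝ) ≤ #V * (1 - θ / S) ^ q := by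
  rcases V.eq_empty_or_nonempty with rfl | hV
  · exact ⟨∅, by simp, by simp, by simp⟩
  have hθS : θ ≤ S := by
    obtain ⟨v, hv⟩ := hV
    have h1 := hN v hv
    have h2 : ∑ y ∈ N v, ν y ≤ ∑ y, ν y := sum_le_sum_of_subset (subset_univ _)
    have h3 : ((∑ y ∈ N v, ν y : ℕ) : ℝ) ≤ ((∑ y, ν y : ℕ) : ℝ) := by exact_mod_cast h2
    linarith
  have hSpos : 0 < S := by linarith
  have hr : 0 ≤ 1 - θ / S := by
    rw [sub_nonneg, div_le_one hSpos]; exact hθS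
  induction q with
  | zero => 
    refine ⟨∅, by simp, by simp, ?_⟩
    simp
  | succ q ih =>
    obtain ⟨T, hT1, hT2, hT3⟩ := ih
    set B := V.filter (fun v => ∀ y ∈ N v, y ∉ T) with hB
    rcases B.eq_empty_or_nonempty with hBe | hBn
    · refine ⟨T, by omega, hT2, ?_⟩
      rw [← hB, hBe]
      simp
      positivity
    · obtain ⟨y, hy⟩ := greedy_step B N ν S θ hS hθ hBn
        (fun v hv => hN v (mem_filter.1 hv).1)
      have hBpos : (0 : ℝ) < #B := by exact_mod_cast hBn.card_pos
      refine ⟨insert y T, (card_insert_le _ _).trans (by omega), ?_, ?_⟩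
      · intro y' hy'
        rcases mem_insert.1 hy' with rfl | h'
        · have hpos : (0 : ℝ) < #(B.filter (fun v => y' ∈ N v)) := by
            by_contra hc
            have : (#(B.filter (fun v => y' ∈ N v)) : ℝ) ≤ 0 := by linarith
            nlinarith [mul_pos hθ hBpos]
          obtain ⟨v, hv⟩ := card_pos.1 (by exact_mod_cast hpos)
          exact ⟨v, (mem_filter.1 (mem_filter.1 hv).1).1, (mem_filter.1 hv).2⟩
        · exact hT2 _ h'
      · have hsub : V.filter (fun v => ∀ z ∈ N v, z ∉ insert y T) ⊆
            B.filter (fun v => ¬ (y ∈ N v)) := by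
          intro v hv
          simp only [B, mem_filter, mem_insert, not_or] at hv ⊢
          exact ⟨⟨hv.1, fun z hz => (hv.2 z hz).2⟩, fun hc => (hv.2 y hc).1 rfl⟩
        have h1 : (#(V.filter (fun v => ∀ z ∈ N v, z ∉ insert y T)) : ℝ) ≤
            #(B.filter (fun v => ¬ (y ∈ N v))) := by exact_mod_cast card_le_card hsub
        have h2 : (#(B.filter (fun v => y ∈ N v)) : ℝ) + #(B.filter (fun v => ¬ (y ∈ N v)))
            = #B := by exact_mod_cast card_filter_add_card_filter_not _
        have h3 : θ / S * #B ≤ #(B.filter (fun v => y ∈ N v)) := by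
          rw [div_mul_eq_mul_div, div_le_iff₀ hSpos]
          linarith
        calc _ ≤ (#B : ℝ) * (1 - θ / S) := by linarith
          _ ≤ (#V * (1 - θ / S) ^ q) * (1 - θ / S) := mul_le_mul_of_nonneg_right hT3 hr
          _ = _ := by ring

/-- the boundary -/
def bd (D A G : Finset F) : Finset F := G.filter (fun v => ∃ x ∈ D, v + x ∉ A)

theorem card_bd (h : Core D A G t) : #(bd D A G) ≤ t * #D := by
  refine le_trans ?_ h.sum_bdeg
  calc #(bd D A G) = ∑ v ∈ bd D A G, 1 := by simp
    _ ≤ ∑ v ∈ bd D A G, bdeg D A v := by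
      apply sum_le_sum
      intro v hv
      obtain ⟨x, hx, hx2⟩ := (mem_filter.1 hv).2
      exact card_pos.2 ⟨x, mem_filter.2 ⟨hx, hx2⟩⟩
    _ ≤ _ := sum_le_sum_of_subset (filter_subset _ _)

theorem neg4 (h : Core D A G t) {z : F} (hz : z ∈ 4 • D) : -z ∈ 4 • D := by
  have e : 4 • D = (D + D) + (D + D) := by abel
  rw [e] at hz ⊢
  obtain ⟨x, hx, y, hy, rfl⟩ := Finset.mem_add.1 hz
  exact Finset.mem_add.2 ⟨-x, h.neg2 hx, -y, h.neg2 hy, by abel⟩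

theorem packing (h : Core D A G t) (hD : 0 < #D) :
    ∃ R : Finset F, #R * #D ≤ 4 * t ∧ bd D A G ⊆ R + 8 • D := by
  set B : F → Finset F := fun v => G.filter (fun y => ∃ s ∈ 4 • D, y = v + s) with hB
  have hloc : ∀ v ∈ bd D A G, #D * #D ≤ 4 * ∑ y ∈ B v, bdeg D A y := by
    intro v hv
    obtain ⟨h1, x, hx, hx2⟩ := mem_filter.1 hv
    exact h.local_bdeg h1 hx hx2
  set Fam := (bd D A G).powerset.filter
    (fun R => ∀ a ∈ R, ∀ b ∈ R, a ≠ b → Disjoint (B a) (B b)) with hFam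
  have hne : Fam.Nonempty := ⟨∅, by simp [hFam]⟩
  obtain ⟨R, hR, hmax⟩ := exists_max_image Fam card hne
  simp only [hFam, mem_filter, mem_powerset] at hR
  obtain ⟨hRsub, hRd⟩ := hR
  refine ⟨R, ?_, ?_⟩
  · have h1 := Finset.card_nsmul_le_sum R (fun v => 4 * ∑ y ∈ B v, bdeg D A y) (#D * #D)
      (fun v hv => hloc v (hRsub hv))
    rw [← mul_sum, smul_eq_mul, ← sum_biUnion hRd] at h1
    have h2 : ∑ y ∈ R.biUnion B, bdeg D A y ≤ t * #D := by
      refine le_trans ?_ h.sum_bdeg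
      apply sum_le_sum_of_subset
      intro y hy
      obtain ⟨v, _, hv⟩ := mem_biUnion.1 hy
      exact (mem_filter.1 hv).1
    have h3 : (#R * #D) * #D ≤ (4 * t) * #D := by nlinarith
    exact Nat.le_of_mul_le_mul_right h3 hD
  · intro v hv
    obtain ⟨x0, hx0⟩ := card_pos.1 hD
    have e8 : 8 • D = 4 • D + 4 • D := by rw [← add_nsmul]
    have zero4 : (0 : F) ∈ 4 • D := by
      have e : 4 • D = (D + D) + (D + D) := by abel
      rw [e]
      have z2 : (0 : F) ∈ D + D := mem_add.2 ⟨x0, hx0, -x0, h.neg _ hx0, by simp⟩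
      exact mem_add.2 ⟨0, z2, 0, z2, by simp⟩
    by_cases hvR : v ∈ R
    · exact mem_add.2 ⟨v, hvR, 0, by rw [e8]; exact mem_add.2 ⟨0, zero4, 0, zero4, by simp⟩,
        by simp⟩
    · have hnot : insert v R ∉ Fam := by
        intro hc
        have := hmax _ hc
        rw [card_insert_of_notMem hvR] at this
        omega
      have hex : ∃ r ∈ R, ¬ Disjoint (B v) (B r) := by
        by_contra hc
        push Not at hc
        apply hnot
        simp only [hFam, mem_filter, mem_powerset]
        refine ⟨insert_subset hv hRsub, ?_⟩
        intro a ha b hb hab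
        rcases mem_insert.1 ha with rfl | ha' <;> rcases mem_insert.1 hb with rfl | hb'
        · exact absurd rfl hab
        · exact hc _ hb'
        · exact (hc _ ha').symm
        · exact hRd _ ha' _ hb' hab
      obtain ⟨r, hr, hd⟩ := hex
      obtain ⟨y, hy1, hy2⟩ := Finset.not_disjoint_iff.1 hd
      obtain ⟨s, hs, e1⟩ := (mem_filter.1 hy1).2
      obtain ⟨s', hs', e2⟩ := (mem_filter.1 hy2).2
      refine mem_add.2 ⟨r, hr, s' + -s, by rw [e8]; exact add_mem_add hs' (h.neg4 hs), ?_⟩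
      have : v + s = r + s' := e1.symm.trans e2
      rw [← add_assoc, ← this]
      abel

theorem d_le (h : Core D A G t) (hD : 0 < #D) (hb : (bd D A G).Nonempty) : #D ≤ 4 * t := by
  obtain ⟨R, h1, h2⟩ := h.packing hD
  obtain ⟨v, hv⟩ := hb
  obtain ⟨r, hr, _⟩ := mem_add.1 (h2 hv)
  have : 0 < #R := card_pos.2 ⟨r, hr⟩
  nlinarith

theorem main [Fintype F] (h : Core D A G t) (hb : (bd D A G).Nonempty) (l : ℕ) (hl : 1 ≤ l)
    (hdl : 16 * l ^ 7 ≤ #D) (hexp : (#D : ℝ) ≤ Real.exp l) :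
    ∃ R T : Finset F, #R * #D ≤ 4 * t ∧ T ⊆ R + 10 • D ∧ #T * l ^ 3 ≤ 9 * t ∧
      bd D A G ⊆ T + (D + D) := by
  have hl7 : 1 ≤ l ^ 7 := Nat.one_le_pow _ _ hl
  have hD : 0 < #D := by omega
  have hD2 : 0 < #(D + D) := by
    obtain ⟨x, hx⟩ := card_pos.1 hD
    exact card_pos.2 ⟨x + x, add_mem_add hx hx⟩
  have hdt := h.d_le hD hb
  obtain ⟨R, hR1, hR2⟩ := h.packing hD
  set m := 4 * l ^ 7 with hm
  set M := l ^ 4 with hM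
  have hMle : M ≤ l ^ 7 := Nat.pow_le_pow_right hl (by norm_num)
  have hM1 : 1 ≤ M := Nat.one_le_pow _ _ hl
  set N : F → Finset F := fun v => (D + D).image (fun s => v + s) with hN
  set V := (bd D A G).filter
    (fun v => 2 * M * (#D * #(D + D)) ≤ ∑ y ∈ N v, wt D A G y) with hV
  have htpos : 0 < t := by omega
  have htR : (0 : ℝ) < t := by exact_mod_cast htpos
  have hlR : (1 : ℝ) ≤ l := by exact_mod_cast hl
  have hdR : (0 : ℝ) < #D := by exact_mod_cast hD
  have hd2R : (0 : ℝ) < #(D + D) := by exact_mod_cast hD2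
  set q := ⌈(3 * t / l ^ 3 : ℝ)⌉₊ with hq
  obtain ⟨T0, hT1, hT2, hT3⟩ := greedy V N (wt D A G) (3 * t * (#D * #(D + D)) : ℝ)
    (2 * M * (#D * #(D + D)) : ℝ) (by exact_mod_cast h.sum_wt)
    (by have : (1 : ℝ) ≤ M := by exact_mod_cast hM1
        positivity)
    (by intro v hv
        have := (mem_filter.1 hv).2
        exact_mod_cast this) q
  set Z := V.filter (fun v => ∀ y ∈ N v, y ∉ T0) with hZ
  set W0 := (W D A G (4 * M) m).filter (fun w => ∃ v ∈ bd D A G, ∃ s ∈ D + D, w = v + s) with hW0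
  obtain ⟨x0, hx0⟩ := card_pos.1 hD
  have z2 : (0 : F) ∈ D + D := mem_add.2 ⟨x0, hx0, -x0, h.neg _ hx0, by simp⟩
  have near : ∀ y ∈ T0 ∪ Z ∪ W0, ∃ v ∈ bd D A G, ∃ s ∈ D + D, y = v + s := by
    intro y hy
    rcases mem_union.1 hy with hy | hy
    · rcases mem_union.1 hy with hy | hy
      · obtain ⟨v, hv, hyv⟩ := hT2 y hy
        obtain ⟨s, hs, rfl⟩ := mem_image.1 hyv
        exact ⟨v, (mem_filter.1 hv).1, s, hs, rfl⟩
      · exact ⟨y, (mem_filter.1 (mem_filter.1 hy).1).1, 0, z2, by simp⟩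
    · exact (mem_filter.1 hy).2
  refine ⟨R, T0 ∪ Z ∪ W0, hR1, ?_, ?_, ?_⟩
  · intro y hy
    obtain ⟨v, hv, s, hs, rfl⟩ := near y hy
    have e10 : 10 • D = 8 • D + (D + D) := by
      rw [← two_nsmul, ← add_nsmul]
    rw [e10, ← add_assoc]
    exact add_mem_add (hR2 hv) hs
  · -- size
    have hTR : (#T0 : ℝ) ≤ 3 * t / l ^ 3 + 1 := by
      have h1 : (#T0 : ℝ) ≤ q := by exact_mod_cast hT1
      have h2 : (q : ℝ) < 3 * t / l ^ 3 + 1 := Nat.ceil_lt_add_one (by positivity)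
      linarith
    have hZR : (#Z : ℝ) ≤ t / #D := by
      have hVc : (#V : ℝ) ≤ t * #D := by
        exact_mod_cast (card_le_card (filter_subset _ _)).trans h.card_bd
      have hratio : (2 * M * (#D * #(D + D)) : ℝ) / (3 * t * (#D * #(D + D))) = 2 * M / (3 * t) := by
        field_simp
      rw [hratio] at hT3
      rcases Nat.eq_zero_or_pos (#Z) with hz0 | hzpos
      · rw [hz0]; simp; positivity
      have hr0 : (0 : ℝ) ≤ 1 - 2 * M / (3 * t) := by
        obtain ⟨v, hv⟩ := card_pos.1 hzpos
        have h1 := (mem_filter.1 (mem_filter.1 hv).1).2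
        have h2 : ∑ y ∈ N v, wt D A G y ≤ ∑ y, wt D A G y := sum_le_sum_of_subset (subset_univ _)
        have h3 := (h1.trans h2).trans h.sum_wt
        have h4 : 2 * M ≤ 3 * t := Nat.le_of_mul_le_mul_right h3 (by positivity)
        rw [sub_nonneg, div_le_one (by positivity)]
        exact_mod_cast h4
      have hpow : (1 - 2 * M / (3 * t) : ℝ) ^ q ≤ Real.exp (-(2 * l)) := by
        calc (1 - 2 * M / (3 * t) : ℝ) ^ q ≤ (Real.exp (-(2 * M / (3 * t)))) ^ q := by
              apply pow_le_pow_left₀ hr0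
              have := Real.add_one_le_exp (-(2 * M / (3 * t)) : ℝ)
              linarith
          _ = Real.exp (q * (-(2 * M / (3 * t)))) := by rw [← Real.exp_nat_mul]
          _ ≤ _ := by
              apply Real.exp_le_exp.2
              have h1 : (3 * t / l ^ 3 : ℝ) ≤ q := Nat.le_ceil _
              have h2 : (3 * t / l ^ 3 : ℝ) * (2 * M / (3 * t)) = 2 * l := by
                rw [hM]; push_cast; field_simp
              have h3 := mul_le_mul_of_nonneg_right h1 (by positivity : (0 : ℝ) ≤ 2 * M / (3 * t))
              linarith
      have hexp2 : Real.exp (-(2 * l)) ≤ 1 / (#D : ℝ) ^ 2 := by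
        rw [Real.exp_neg, ← one_div]
        apply one_div_le_one_div_of_le (by positivity)
        calc (#D : ℝ) ^ 2 ≤ (Real.exp l) ^ 2 := pow_le_pow_left₀ hdR.le hexp 2
          _ = _ := by rw [← Real.exp_nat_mul]; norm_num
      calc (#Z : ℝ) ≤ _ := hT3
        _ ≤ (t * #D) * (1 / (#D : ℝ) ^ 2) := by
            apply mul_le_mul hVc (hpow.trans hexp2) (pow_nonneg hr0 _) (by positivity)
        _ = _ := by field_simp
    have hWn : #W0 * l ^ 3 ≤ 4 * t := by
      have h1 := h.card_W hD (4 * M) m (by omega)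
      have h2 : #W0 ≤ #(W D A G (4 * M) m) := card_le_card (filter_subset _ _)
      have h3 : (#W0 * l ^ 3) * (4 * l ^ 4) ≤ (4 * t) * (4 * l ^ 4) := by
        calc (#W0 * l ^ 3) * (4 * l ^ 4) = #W0 * m := by rw [hm]; ring
          _ ≤ #(W D A G (4 * M) m) * m := Nat.mul_le_mul_right _ h2
          _ ≤ _ := h1
      exact Nat.le_of_mul_le_mul_right h3 (by omega)
    have hl3 : l ^ 3 ≤ l ^ 7 := Nat.pow_le_pow_right hl (by norm_num)
    have hc : #(T0 ∪ Z ∪ W0) ≤ #T0 + #Z + #W0 :=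
      (card_union_le _ _).trans (Nat.add_le_add_right (card_union_le _ _) _)
    have hc' : #(T0 ∪ Z ∪ W0) * l ^ 3 ≤ (#T0 + #Z + #W0) * l ^ 3 := Nat.mul_le_mul_right _ hc
    refine hc'.trans ?_
    have hl3pos : (0 : ℝ) < (l : ℝ) ^ 3 := by positivity
    have hA1 : (#T0 : ℝ) * l ^ 3 ≤ 3 * t + l ^ 3 := by
      calc (#T0 : ℝ) * l ^ 3 ≤ (3 * t / l ^ 3 + 1) * l ^ 3 :=
            mul_le_mul_of_nonneg_right hTR hl3pos.le
        _ = _ := by field_simp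
    have hl3t : ((l : ℝ)) ^ 3 ≤ t := by
      have : l ^ 3 ≤ t := by omega
      exact_mod_cast this
    have hl3d : ((l : ℝ)) ^ 3 ≤ #D := by
      have : l ^ 3 ≤ #D := by omega
      exact_mod_cast this
    have hA2 : (#Z : ℝ) * l ^ 3 ≤ t := by
      calc (#Z : ℝ) * l ^ 3 ≤ (t / #D) * #D := by
            apply mul_le_mul hZR hl3d hl3pos.le (by positivity)
        _ = t := by field_simp
    have hA3 : (#W0 : ℝ) * l ^ 3 ≤ 4 * t := by exact_mod_cast hWn
    have : ((#T0 : ℝ) + #Z + #W0) * l ^ 3 ≤ 9 * t := by linarith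
    exact_mod_cast this
  · intro v hv
    have hfin : ∃ y ∈ T0 ∪ Z ∪ W0, ∃ s ∈ D + D, y = v + s := by
      obtain ⟨hvG, x, hx, hvx⟩ := mem_filter.1 hv
      rcases h.dichotomy M m (by omega) (by omega) hvG hx hvx with ⟨w, hw, s, hs, e⟩ | hmass
      · exact ⟨w, mem_union_right _ (mem_filter.2 ⟨hw, v, hv, s, hs, e⟩), s, hs, e⟩
      · have hvV : v ∈ V := mem_filter.2 ⟨hv, hmass⟩
        by_cases hvZ : v ∈ Z
        · exact ⟨v, mem_union_left _ (mem_union_right _ hvZ), 0, z2, by simp⟩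
        · have : ∃ y ∈ N v, y ∈ T0 := by
            by_contra hc
            push Not at hc
            exact hvZ (mem_filter.2 ⟨hvV, hc⟩)
          obtain ⟨y, hy, hyT⟩ := this
          obtain ⟨s, hs, e⟩ := mem_image.1 hy
          exact ⟨y, mem_union_left _ (mem_union_left _ hyT), s, hs, e.symm⟩
    obtain ⟨y, hy, s, hs, e⟩ := hfin
    exact mem_add.2 ⟨y, hy, -s, h.neg2 hs, by rw [e]; abel⟩

end Core

theorem count_small {α : Type} [DecidableEq α] (S : Finset α) (x r : ℝ) (hx : 0 < x) (hx1 : x ≤ 1) :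
    ((S.powerset.filter (fun T => (T.card : ℝ) ≤ r)).card : ℝ) ≤
      x ^ (-r) * Real.exp (x * S.card) := by
  have h1 : ((S.powerset.filter (fun T => (T.card : ℝ) ≤ r)).card : ℝ) ≤
      ∑ T ∈ S.powerset.filter (fun T => (T.card : ℝ) ≤ r), x ^ (-r) * x ^ T.card := by
    rw [Finset.card_eq_sum_ones]
    push_cast
    apply Finset.sum_le_sum
    intro T hT
    have hT2 := (Finset.mem_filter.1 hT).2
    rw [← Real.rpow_natCast, ← Real.rpow_add hx]
    apply Real.one_le_rpow_of_pos_of_le_one_of_nonpos hx hx1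
    linarith
  refine h1.trans ?_
  have h2 : ∑ T ∈ S.powerset.filter (fun T => (T.card : ℝ) ≤ r), x ^ (-r) * x ^ T.card ≤
      ∑ T ∈ S.powerset, x ^ (-r) * x ^ T.card := by
    apply Finset.sum_le_sum_of_subset_of_nonneg (Finset.filter_subset _ _)
    intro T _ _
    positivity
  refine h2.trans ?_
  rw [← Finset.mul_sum]
  apply mul_le_mul_of_nonneg_left _ (by positivity)
  have h3 := Finset.sum_pow_mul_eq_add_pow x 1 S
  simp only [one_pow, mul_one] at h3
  rw [h3]
  calc (x + 1) ^ S.card ≤ (Real.exp x) ^ S.card :=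
        pow_le_pow_left₀ (by positivity) (Real.add_one_le_exp x) _
    _ = _ := by rw [← Real.exp_nat_mul, mul_comm]

theorem exp_le_two_rpow (x : ℝ) (hx : 0 ≤ x) : Real.exp x ≤ (2 : ℝ) ^ (2 * x) := by
  rw [Real.rpow_def_of_pos (by norm_num)]
  apply Real.exp_le_exp.2
  have := Real.log_two_gt_d9
  nlinarith

theorem exists_core (n : ℕ) (F : Type) [AddCommGroup F] [Fintype F] [DecidableEq F]
    (hF : Fintype.card F = 2 * n) (X : AddSubgroup F) (hX : X.index = 2) (D : Finset F)
    (hDX : (D : Set F) ⊆ ((X : Set F))ᶜ) (hneg : ∀ x ∈ D, -x ∈ D)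
    (hgen : AddSubgroup.closure (D : Set F) = ⊤) (a g : ℕ) (A : Set F) (hA : A ⊆ (X : Set F))
    (hlink : TwoLinked (D : Set F) A)
    (hsmall : 2 * (closureSet (D : Set F) (X : Set F) A).ncard ≤ n)
    (ha : (closureSet (D : Set F) (X : Set F) A).ncard = a) (hg : (A + (D : Set F)).ncard = g) :
    ∃ (Af Gf : Finset F) (t : ℕ), Core D Af Gf t ∧ (Core.bd D Af Gf).Nonempty ∧
      boundarySet (D : Set F) (X : Set F) A ⊆ (Core.bd D Af Gf : Set F) ∧
      (g : ℝ) - a = t ∧ 0 < D.card ∧ 0 < n := by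
  have hn : 0 < n := by
    have : 0 < Fintype.card F := Fintype.card_pos
    omega
  have hDne : D.Nonempty := by
    rw [Finset.nonempty_iff_ne_empty]
    rintro rfl
    rw [Finset.coe_empty, AddSubgroup.closure_empty] at hgen
    have h1 : X = ⊤ := by
      rw [eq_top_iff, ← hgen]; exact bot_le
    rw [h1, AddSubgroup.index_top] at hX
    omega
  obtain ⟨x0, hx0⟩ := hDne
  have hAne : A.Nonempty := by
    have := hlink.nonempty
    exact Set.nonempty_coe_sort.1 this
  set Ac := closureSet (D : Set F) (X : Set F) A with hAc
  set Gc := A + (D : Set F) with hGc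
  have hAAc : A ⊆ Ac := by
    intro u hu
    exact ⟨hA hu, Set.add_subset_add_right (Set.singleton_subset_iff.2 hu)⟩
  have hGX : ∀ v ∈ Gc, v ∉ X := by
    rintro v ⟨u, hu, x, hx, rfl⟩ hc
    have h1 : x ∉ X := hDX hx
    exact h1 ((X.add_mem_cancel_left (hA hu)).1 hc)
  have h1 : ∀ u ∈ Ac, ∀ x ∈ D, u + x ∈ Gc := by
    intro u hu x hx
    exact hu.2 (Set.add_mem_add rfl hx)
  have h2 : ∀ u, u ∉ Ac → ∃ x ∈ D, u + x ∉ Gc := by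
    intro u hu
    by_cases huX : u ∈ X
    · have : ¬ (({u} : Set F) + (D : Set F) ⊆ A + (D : Set F)) := fun hc => hu ⟨huX, hc⟩
      obtain ⟨y, hy, hy2⟩ := Set.not_subset.1 this
      obtain ⟨u', hu', x, hx, rfl⟩ := hy
      rw [Set.mem_singleton_iff] at hu'
      subst hu'
      exact ⟨x, hx, hy2⟩
    · refine ⟨x0, hx0, fun hc => hGX _ hc ?_⟩
      have : x0 ∉ X := hDX hx0
      rw [AddSubgroup.add_mem_iff_of_index_two hX]
      tauto
  have h3 : ∀ v ∈ Gc, ∃ x ∈ D, v + x ∈ Ac := by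
    rintro v ⟨u, hu, x, hx, rfl⟩
    exact ⟨-x, hneg x hx, by simpa using hAAc hu⟩
  obtain ⟨Af, hAf⟩ : ∃ Af : Finset F, (Af : Set F) = Ac := ⟨(Set.toFinite Ac).toFinset, by simp⟩
  obtain ⟨Gf, hGf⟩ : ∃ Gf : Finset F, (Gf : Set F) = Gc := ⟨(Set.toFinite Gc).toFinset, by simp⟩
  have mA : ∀ u, u ∈ Af ↔ u ∈ Ac := fun u => by rw [← hAf]; simp
  have mG : ∀ u, u ∈ Gf ↔ u ∈ Gc := fun u => by rw [← hGf]; simp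
  have cA : Af.card = a := by rw [← ha, ← hAf, Set.ncard_coe_finset]
  have cG : Gf.card = g := by rw [← hg, ← hGf, Set.ncard_coe_finset]
  have hle : Af.card ≤ Gf.card := by
    apply Finset.card_le_card_of_injOn (fun u => u + x0)
    · intro u hu
      exact (mG _).2 (h1 u ((mA u).1 hu) x0 hx0)
    · intro a _ b _ hab
      simpa using hab
  have hcore : Core D Af Gf (g - a) := by
    refine ⟨hneg, ?_, ?_, ?_, by omega⟩
    · intro u hu x hx
      exact (mG _).2 (h1 u ((mA u).1 hu) x hx)
    · intro u hu
      obtain ⟨x, hx, hx2⟩ := h2 u (fun hc => hu ((mA u).2 hc))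
      exact ⟨x, hx, fun hc => hx2 ((mG _).1 hc)⟩
    · intro v hv
      obtain ⟨x, hx, hx2⟩ := h3 v ((mG v).1 hv)
      exact ⟨x, hx, (mA _).2 hx2⟩
  refine ⟨Af, Gf, g - a, hcore, ?_, ?_, ?_, Finset.card_pos.2 ⟨x0, hx0⟩, hn⟩
  · by_contra hemp
    rw [Finset.not_nonempty_iff_eq_empty] at hemp
    have hclosed : ∀ v ∈ Gc, ∀ x ∈ D, v + x ∈ Ac := by
      intro v hv x hx
      by_contra hc
      have : v ∈ Core.bd D Af Gf :=
        Finset.mem_filter.2 ⟨(mG v).2 hv, x, hx, fun hh => hc ((mA _).1 hh)⟩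
      rw [hemp] at this
      simp at this
    have hstep : ∀ f ∈ AddSubgroup.closure (D : Set F),
        ∀ s ∈ Ac ∪ Gc, s + f ∈ Ac ∪ Gc ∧ s + -f ∈ Ac ∪ Gc := by
      intro f hf
      induction hf using AddSubgroup.closure_induction with
      | mem x hx =>
        intro s hs
        rcases hs with hs | hs
        · exact ⟨Or.inr (h1 s hs x hx), Or.inr (h1 s hs _ (hneg x hx))⟩
        · exact ⟨Or.inl (hclosed s hs x hx), Or.inl (hclosed s hs _ (hneg x hx))⟩
      | zero => intro s hs; simpa using hs
      | add x y _ _ ihx ihy =>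
        intro s hs
        refine ⟨?_, ?_⟩
        · rw [← add_assoc]
          exact (ihy _ (ihx s hs).1).1
        · have := (ihy _ (ihx s hs).2).2
          convert this using 1
          abel
      | neg x _ ih =>
        intro s hs
        rw [neg_neg]
        exact (ih s hs).symm
    obtain ⟨u0, hu0⟩ := hAne
    have hall : ∀ f, f ∈ Ac ∪ Gc := by
      intro f
      have := (hstep (f - u0) (by rw [hgen]; trivial) u0 (Or.inl (hAAc hu0))).1
      simpa using this
    have hXA : (X : Set F) ⊆ Ac := by
      intro f hf
      rcases hall f with hh | hh
      · exact hh
      · exact absurd hf (hGX f hh)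
    have h4 := Set.ncard_le_ncard hXA (Set.toFinite _)
    have h5 := X.card_mul_index
    rw [hX, Nat.card_eq_fintype_card (α := F), hF] at h5
    have h6 : (X : Set F).ncard = Nat.card X := rfl
    omega
  · rintro v ⟨hv, hv2⟩
    obtain ⟨y, hy, hy2⟩ := Set.not_subset.1 hv2
    obtain ⟨u', hu', x, hx, rfl⟩ := hy
    rw [Set.mem_singleton_iff] at hu'
    subst hu'
    exact Finset.mem_coe.2 (Finset.mem_filter.2 ⟨(mG _).2 hv, x, hx, fun hh => hy2 ((mA _).1 hh)⟩)
  · rw [Nat.cast_sub (by omega)]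

theorem stmt16 :
    ∃ C K₁ K₂ : ℝ, 0 < C ∧ 0 < K₁ ∧ 0 < K₂ ∧
      ∀ (n : ℕ) (F : Type) [AddCommGroup F] [Fintype F],
        Fintype.card F = 2 * n →
        ∀ X : AddSubgroup F, X.index = 2 →
          ∀ D : Set F, D ⊆ ((↑X : Set F))ᶜ → (∀ x ∈ D, -x ∈ D) →
            AddSubgroup.closure D = ⊤ →
            ∀ d : ℕ, D.ncard = d →
              C * (logb 2 d) ^ (8 : ℕ) * logb 2 n ≤ (d : ℝ) →
              (d : ℝ) ≤ (n : ℝ) ^ ((1 : ℝ) / 3) →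
              (d : ℝ) * (logb 2 d) ^ (3 : ℕ) ≤ ((D + D).ncard : ℝ) →
              ∀ a g : ℕ,
                ∃ 𝒞₁ : Set (Set F),
                  (∀ C₀ ∈ 𝒞₁, C₀ ⊆ ((↑X : Set F))ᶜ ∧
                    (C₀.ncard : ℝ) ≤
                      K₁ * ((g : ℝ) - (a : ℝ)) * ((D + D).ncard : ℝ) / (logb 2 d) ^ 3) ∧
                  (𝒞₁.ncard : ℝ) ≤ 2 ^ (K₂ * ((g : ℝ) - (a : ℝ)) / logb 2 d) ∧
                  ∀ A : Set F, A ⊆ (↑X : Set F) → TwoLinked D A →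
                    2 * (closureSet D (↑X) A).ncard ≤ n →
                    (closureSet D (↑X) A).ncard = a → (A + D).ncard = g →
                    ∃ C₀ ∈ 𝒞₁, boundarySet D (↑X) A ⊆ C₀ := by
  classical
  refine ⟨2 ^ 13, 9, 108, by norm_num, by norm_num, by norm_num, ?_⟩
  intro n F _ _ hF X hX D0 hDX hneg hgen d hd hC hdn _ a g
  obtain ⟨D, rfl⟩ : ∃ D : Finset F, (D : Set F) = D0 := ⟨(Set.toFinite D0).toFinset, by simp⟩
  by_cases hex : ∃ A : Set F, A ⊆ (X : Set F) ∧ TwoLinked (D : Set F) A ∧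
      2 * (closureSet (D : Set F) (X : Set F) A).ncard ≤ n ∧
      (closureSet (D : Set F) (X : Set F) A).ncard = a ∧ (A + (D : Set F)).ncard = g
  swap
  · refine ⟨∅, by simp, ?_, ?_⟩
    · simp only [Set.ncard_empty, Nat.cast_zero]
      positivity
    · intro A h1 h2 h3 h4 h5
      exact absurd ⟨A, h1, h2, h3, h4, h5⟩ hex
  have hD2 : ((D : Set F) + (D : Set F)).ncard = (D + D).card := by
    rw [← Finset.coe_add, Set.ncard_coe_finset]
  rw [hD2]
  rw [Set.ncard_coe_finset] at hd
  have hneg' : ∀ x ∈ D, -x ∈ D := fun x hx => hneg x hx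
  -- numerical facts
  have hcore := fun A h1 h2 h3 h4 h5 =>
    exists_core n F hF X hX D hDX hneg' hgen a g A h1 h2 h3 h4 h5
  obtain ⟨A1, b1, b2, b3, b4, b5⟩ := hex
  obtain ⟨Af1, Gf1, t, hc1, hne1, _, hgat, hDpos, hn⟩ := hcore A1 b1 b2 b3 b4 b5
  have hd2 : 2 ≤ d := by
    obtain ⟨v, hv⟩ := hne1
    obtain ⟨hvG, x, hx, hx2⟩ := Finset.mem_filter.1 hv
    obtain ⟨y, hy, hy2⟩ := hc1.h3 v hvG
    rw [← hd]
    exact Finset.one_lt_card.2 ⟨x, hx, y, hy, fun hxy => hx2 (hxy ▸ hy2)⟩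
  have hd4t : d ≤ 4 * t := by
    rw [← hd]; exact hc1.d_le hDpos hne1
  rw [hgat]
  set L := logb 2 (d : ℝ) with hL
  set lN := logb 2 (n : ℝ) with hlN
  have hdR : (2 : ℝ) ≤ d := by exact_mod_cast hd2
  have hdpos : (0 : ℝ) < d := by linarith
  have hnR : (1 : ℝ) ≤ n := by exact_mod_cast hn
  have hnpos : (0 : ℝ) < n := by linarith
  have hL1 : 1 ≤ L := by
    rw [hL, Real.le_logb_iff_rpow_le (by norm_num) hdpos]
    simpa using hdR
  have hdn' : (d : ℝ) ≤ n := by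
    refine hdn.trans ?_
    calc (n : ℝ) ^ ((1 : ℝ) / 3) ≤ (n : ℝ) ^ (1 : ℝ) :=
          Real.rpow_le_rpow_of_exponent_le hnR (by norm_num)
      _ = n := Real.rpow_one _
  have hlN1 : 1 ≤ lN := by
    rw [hlN, Real.le_logb_iff_rpow_le (by norm_num) hnpos]
    simp only [Real.rpow_one]
    linarith
  have hpowd : (2 : ℝ) ^ L = d := Real.rpow_logb (by norm_num) (by norm_num) hdpos
  have hpown : (2 : ℝ) ^ lN = n := Real.rpow_logb (by norm_num) (by norm_num) hnpos
  have hLpos : 0 < L := by linarith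
  have hL8 : L ≤ L ^ 8 := le_self_pow₀ hL1 (by norm_num)
  have hL7 : L ^ 7 ≤ L ^ 8 := pow_le_pow_right₀ hL1 (by norm_num)
  have hdL7 : 2 ^ 13 * L ^ 7 ≤ (d : ℝ) := by
    refine le_trans ?_ hC
    have : 0 ≤ L ^ 8 := by positivity
    nlinarith
  have hdLN : 2 ^ 13 * (L * lN) ≤ (d : ℝ) := by
    refine le_trans ?_ hC
    have : L * lN ≤ L ^ 8 * lN := mul_le_mul_of_nonneg_right hL8 (by linarith)
    nlinarith
  have htR : (d : ℝ) ≤ 4 * t := by exact_mod_cast hd4t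
  have htpos : (0 : ℝ) < t := by linarith
  have hdL : 2 ^ 13 * L ≤ (d : ℝ) := by
    refine le_trans ?_ hdLN
    nlinarith
  set l := ⌈L⌉₊ with hl
  have hlL : L ≤ l := Nat.le_ceil _
  have hl1 : 1 ≤ l := by
    have : (1 : ℝ) ≤ l := hL1.trans hlL
    exact_mod_cast this
  have hl2 : (l : ℝ) ≤ 2 * L := by
    have := Nat.ceil_lt_add_one hLpos.le
    linarith
  have hdl : 16 * l ^ 7 ≤ D.card := by
    rw [hd]
    have h1 : (l : ℝ) ^ 7 ≤ (2 * L) ^ 7 := pow_le_pow_left₀ (by positivity) hl2 7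
    have h2 : (2 * L) ^ 7 = 128 * L ^ 7 := by ring
    have h3 : (0 : ℝ) ≤ L ^ 7 := by positivity
    have : (16 : ℝ) * (l : ℝ) ^ 7 ≤ d := by linarith
    exact_mod_cast this
  have hexp : (D.card : ℝ) ≤ Real.exp l := by
    rw [hd, ← hpowd, Real.rpow_def_of_pos (by norm_num)]
    apply Real.exp_le_exp.2
    have h1 := Real.log_two_lt_d9
    have h2 := Real.log_two_gt_d9
    nlinarith
  set ρ : ℝ := 4 * t / d with hρ
  set τ : ℝ := 9 * t / L ^ 3 with hτ
  set fam : Finset (Set F) := ((Finset.univ : Finset F).powerset.filter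
    (fun R => (R.card : ℝ) ≤ ρ)).biUnion (fun R => ((R + 10 • D).powerset.filter
    (fun T => (T.card : ℝ) ≤ τ)).image
      (fun T => ((T + (D + D) : Finset F) : Set F) ∩ ((X : Set F))ᶜ)) with hfam
  refine ⟨(fam : Set (Set F)), ?_, ?_, ?_⟩
  · intro C0 hC0
    simp only [hfam, Finset.coe_biUnion, Set.mem_iUnion, Finset.mem_coe, Finset.mem_image,
      Finset.mem_filter] at hC0
    obtain ⟨R, hR, T, ⟨_, hT⟩, rfl⟩ := hC0
    refine ⟨Set.inter_subset_right, ?_⟩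
    have h1 : (((T + (D + D) : Finset F) : Set F) ∩ ((X : Set F))ᶜ).ncard ≤
        T.card * (D + D).card := by
      refine (Set.ncard_le_ncard Set.inter_subset_left (Set.toFinite _)).trans ?_
      rw [Set.ncard_coe_finset]
      exact Finset.card_add_le
    calc ((((T + (D + D) : Finset F) : Set F) ∩ ((X : Set F))ᶜ).ncard : ℝ) ≤
        (T.card : ℝ) * (D + D).card := by exact_mod_cast h1
      _ ≤ τ * (D + D).card := mul_le_mul_of_nonneg_right hT (by positivity)
      _ = _ := by rw [hτ]; ring
  · rw [Set.ncard_coe_finset]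
    have hcard := Finset.card_biUnion_le (s := (Finset.univ : Finset F).powerset.filter
      (fun R => (R.card : ℝ) ≤ ρ)) (t := fun R => ((R + 10 • D).powerset.filter
      (fun T => (T.card : ℝ) ≤ τ)).image
        (fun T => ((T + (D + D) : Finset F) : Set F) ∩ ((X : Set F))ᶜ))
    rw [← hfam] at hcard
    have hcardR : (fam.card : ℝ) ≤ ∑ R ∈ (Finset.univ : Finset F).powerset.filter
      (fun R => (R.card : ℝ) ≤ ρ), ((((R + 10 • D).powerset.filter
      (fun T => (T.card : ℝ) ≤ τ)).image
        (fun T => ((T + (D + D) : Finset F) : Set F) ∩ ((X : Set F))ᶜ)).card : ℝ) := by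
      exact_mod_cast hcard
    have hd10 : (1 : ℝ) ≤ (d : ℝ) ^ 10 := one_le_pow₀ (by linarith)
    have hinner : ∀ R ∈ (Finset.univ : Finset F).powerset.filter
      (fun R => (R.card : ℝ) ≤ ρ), ((((R + 10 • D).powerset.filter
      (fun T => (T.card : ℝ) ≤ τ)).image
        (fun T => ((T + (D + D) : Finset F) : Set F) ∩ ((X : Set F))ᶜ)).card : ℝ) ≤
        (2 : ℝ) ^ (90 * t / L) * (2 : ℝ) ^ (8 * t / L) := by
      intro R hR
      have hRρ := (Finset.mem_filter.1 hR).2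
      have h1 : ((((R + 10 • D).powerset.filter
        (fun T => (T.card : ℝ) ≤ τ)).image
        (fun T => ((T + (D + D) : Finset F) : Set F) ∩ ((X : Set F))ᶜ)).card : ℝ) ≤
        (((R + 10 • D).powerset.filter (fun T => (T.card : ℝ) ≤ τ)).card : ℝ) := by
        exact_mod_cast Finset.card_image_le
      have h2 := count_small (R + 10 • D) (((d : ℝ) ^ 10)⁻¹) τ (by positivity)
        (inv_le_one_of_one_le₀ hd10)
      refine (h1.trans h2).trans ?_
      have h3 : (((d : ℝ) ^ 10)⁻¹) ^ (-τ) ≤ (2 : ℝ) ^ (90 * t / L) := by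
        rw [Real.inv_rpow (by positivity), Real.rpow_neg (by positivity), inv_inv, ← hpowd,
          ← Real.rpow_natCast, ← Real.rpow_mul (by positivity), ← Real.rpow_mul (by positivity)]
        apply Real.rpow_le_rpow_of_exponent_le (by norm_num)
        have : L * (((10 : ℕ) : ℝ) * τ) = 90 * t / L ^ 2 := by
          rw [hτ]; push_cast; field_simp; norm_num
        rw [this]
        apply div_le_div_of_nonneg_left (by positivity) hLpos
        exact le_self_pow₀ hL1 (by norm_num)
      have h4 : Real.exp (((d : ℝ) ^ 10)⁻¹ * (R + 10 • D).card) ≤ (2 : ℝ) ^ (8 * t / L) := by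
        have h5 : (R + 10 • D).card ≤ R.card * d ^ 10 := by
          refine Finset.card_add_le.trans ?_
          rw [← hd]
          exact Nat.mul_le_mul_left _ Finset.card_nsmul_le
        have h6 : ((R + 10 • D).card : ℝ) ≤ R.card * (d : ℝ) ^ 10 := by exact_mod_cast h5
        have h7 : ((d : ℝ) ^ 10)⁻¹ * (R + 10 • D).card ≤ R.card := by
          rw [inv_mul_le_iff₀ (by positivity)]
          linarith
        have h8 : 0 ≤ ρ := by positivity
        calc Real.exp (((d : ℝ) ^ 10)⁻¹ * (R + 10 • D).card) ≤ Real.exp ρ :=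
              Real.exp_le_exp.2 (h7.trans hRρ)
          _ ≤ (2 : ℝ) ^ (2 * ρ) := exp_le_two_rpow _ h8
          _ ≤ _ := by
              apply Real.rpow_le_rpow_of_exponent_le (by norm_num)
              have : 2 * ρ = 8 * t / d := by rw [hρ]; ring
              rw [this]
              apply div_le_div_of_nonneg_left (by positivity) hLpos
              linarith
      exact mul_le_mul h3 h4 (by positivity) (by positivity)
    have houter : (((Finset.univ : Finset F).powerset.filter
      (fun R => (R.card : ℝ) ≤ ρ)).card : ℝ) ≤ (2 : ℝ) ^ (8 * t / L) * (2 : ℝ) ^ (2 * t / L) := by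
      have h2 := count_small (Finset.univ : Finset F) ((2 * n : ℝ)⁻¹) ρ (by positivity)
        (inv_le_one_of_one_le₀ (by linarith))
      refine h2.trans ?_
      have h3 : ((2 * n : ℝ)⁻¹) ^ (-ρ) ≤ (2 : ℝ) ^ (8 * t / L) := by
        have e : (2 * n : ℝ) = (2 : ℝ) ^ (1 + lN) := by
          rw [Real.rpow_add (by norm_num), hpown, Real.rpow_one]
        rw [Real.inv_rpow (by positivity), Real.rpow_neg (by positivity), inv_inv, e,
          ← Real.rpow_mul (by norm_num)]
        apply Real.rpow_le_rpow_of_exponent_le (by norm_num)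
        have h4 : (1 + lN) * ρ ≤ (2 * lN) * ρ :=
          mul_le_mul_of_nonneg_right (by linarith) (by positivity)
        refine h4.trans ?_
        rw [hρ, le_div_iff₀ hLpos]
        have : 2 * lN * (4 * t / d) * L = 8 * t * (L * lN) / d := by ring
        rw [this, div_le_iff₀ hdpos]
        apply mul_le_mul_of_nonneg_left _ (by positivity)
        have : 0 ≤ L * lN := by positivity
        linarith
      have h4 : Real.exp ((2 * n : ℝ)⁻¹ * (Finset.univ : Finset F).card) ≤
          (2 : ℝ) ^ (2 * t / L) := by
        have : ((Finset.univ : Finset F).card : ℝ) = 2 * n := by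
          rw [Finset.card_univ, hF]; push_cast; ring
        rw [this, inv_mul_cancel₀ (by positivity)]
        refine (exp_le_two_rpow 1 (by norm_num)).trans ?_
        apply Real.rpow_le_rpow_of_exponent_le (by norm_num)
        rw [le_div_iff₀ hLpos]
        linarith
      exact mul_le_mul h3 h4 (by positivity) (by positivity)
    have hsum := Finset.sum_le_card_nsmul _ _ _ hinner
    rw [nsmul_eq_mul] at hsum
    refine (hcardR.trans hsum).trans ?_
    refine (mul_le_mul_of_nonneg_right houter (by positivity)).trans ?_
    rw [← Real.rpow_add (by norm_num), ← Real.rpow_add (by norm_num),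
      ← Real.rpow_add (by norm_num)]
    apply le_of_eq
    congr 1
    ring
  · intro A h1 h2 h3 h4 h5
    obtain ⟨Af, Gf, t', hc, hne, hsub, hgat', _, _⟩ := hcore A h1 h2 h3 h4 h5
    have htt : t' = t := by
      have : (t' : ℝ) = t := by rw [← hgat', hgat]
      exact_mod_cast this
    subst htt
    obtain ⟨R, T, hR, hTR, hT, hcov⟩ := hc.main hne l hl1 hdl hexp
    refine ⟨((T + (D + D) : Finset F) : Set F) ∩ ((X : Set F))ᶜ, ?_, ?_⟩
    · simp only [hfam, Finset.coe_biUnion, Set.mem_iUnion, Finset.mem_coe, Finset.mem_image,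
        Finset.mem_filter, Finset.mem_powerset]
      refine ⟨R, ⟨Finset.subset_univ _, ?_⟩, T, ⟨hTR, ?_⟩, rfl⟩
      · rw [hρ, le_div_iff₀ hdpos, ← hd]
        exact_mod_cast hR
      · rw [hτ, le_div_iff₀ (by positivity)]
        have h6 : (T.card : ℝ) * (l : ℝ) ^ 3 ≤ 9 * t' := by exact_mod_cast hT
        refine le_trans ?_ h6
        exact mul_le_mul_of_nonneg_left (pow_le_pow_left₀ hLpos.le hlL 3) (by positivity)
    · intro v hv
      refine ⟨Finset.mem_coe.2 (hcov (Finset.mem_coe.1 (hsub hv))), ?_⟩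
      obtain ⟨⟨u, hu, x, hx, rfl⟩, _⟩ := hv
      intro hc
      have h1' : x ∉ X := hDX hx
      exact h1' ((X.add_mem_cancel_left (h1 hu)).1 hc)
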